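/- arXiv:2111.13487 — 2 statements merged into one kernel-verified Lean document; each statement's English description precedes it below -/
import Mathlib

section
/- Let X and Y be independent random variables on a probability space (Ω, 𝓕, ℙ), where X has the Pareto distribution with shape a > 0 and scale θ_X > 0 and Y has the Pareto distribution with the same shape a and scale θ_Y > 0. Then the product Z = X·Y has probability density function f_Z(z) = a²·(θ_X·θ_Y)^{a}·z^{-a-1}·log( z/(θ_X·θ_Y) ) for z > θ_X·θ_Y, and f_Z(z) = 0 for z ≤ θ_X·θ_Y. -/
open MeasureTheory ProbabilityTheory Real

/-- The Pareto probability density function with shape `a` and scale `θ`. -/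
noncomputable def paretoPdf (a θ x : ℝ) : ℝ :=
  if θ < x then a * θ ^ a * x ^ (-(a + 1)) else 0

open Set
open scoped ENNReal

lemma lintegral_comp_mul_left_volume {x : ℝ} (hx : x ≠ 0) (h : ℝ → ℝ≥0∞) :
    ∫⁻ y, h (x * y) = ENNReal.ofReal |x⁻¹| * ∫⁻ z, h z := by
  rw [← smul_eq_mul, ← lintegral_smul_measure, ← Real.map_volume_mul_left hx]
  exact ((Homeomorph.mulLeft₀ x hx).measurableEmbedding.lintegral_map h).symm

/-- The law of the product of two independent real random variables with densities `f` and `g`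
is given by the multiplicative convolution of `f` and `g`. -/
theorem map_mul_eq_withDensity_of_indepFun {Ω : Type*} [MeasurableSpace Ω] {P : Measure Ω}
    [IsFiniteMeasure P] {X Y : Ω → ℝ} (hXm : Measurable X) (hYm : Measurable Y)
    (hindep : IndepFun X Y P) {f g : ℝ → ℝ≥0∞} (hf : Measurable f) (hg : Measurable g)
    (hX : P.map X = volume.withDensity f) (hY : P.map Y = volume.withDensity g) :
    P.map (fun ω => X ω * Y ω)
      = volume.withDensity fun z => ∫⁻ x, f x * (ENNReal.ofReal |x⁻¹| * g (x⁻¹ * z)) := by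
  ext s hs
  have hmul : Measurable fun p : ℝ × ℝ => p.1 * p.2 := by fun_prop
  have hcomp : P.map (fun ω => X ω * Y ω)
      = (P.map fun ω => (X ω, Y ω)).map fun p => p.1 * p.2 :=
    (Measure.map_map hmul (hXm.prodMk hYm)).symm
  have hfiber (x : ℝ) (hx : x ≠ 0) :
      volume.withDensity g (Prod.mk x ⁻¹' ((fun p => p.1 * p.2) ⁻¹' s))
        = ∫⁻ z in s, ENNReal.ofReal |x⁻¹| * g (x⁻¹ * z) := by
    have hms : MeasurableSet (Prod.mk x ⁻¹' ((fun p : ℝ × ℝ => p.1 * p.2) ⁻¹' s)) :=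
      measurable_prodMk_left (hmul hs)
    rw [withDensity_apply _ hms, lintegral_const_mul _ (by fun_prop), ← lintegral_indicator hs,
      ← lintegral_comp_mul_left_volume hx, ← lintegral_indicator hms]
    refine lintegral_congr fun y => ?_
    simp [indicator, hx]
    rfl
  rw [hcomp, hindep.map_prod_eq_prod_map_map hXm.aemeasurable hYm.aemeasurable, hX, hY,
    Measure.map_apply hmul hs, Measure.prod_apply (hmul hs), withDensity_apply _ hs,
    lintegral_withDensity_eq_lintegral_mul _ hf (measurable_measure_prodMk_left (hmul hs)),
    ← lintegral_lintegral_swap (by fun_prop)]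
  refine lintegral_congr_ae ?_
  filter_upwards [Measure.ae_ne volume (0 : ℝ)] with x hx
  rw [Pi.mul_apply, hfiber x hx, lintegral_const_mul (f x) (by fun_prop)]

lemma measurable_paretoPdf (a θ : ℝ) : Measurable (paretoPdf a θ) :=
  Measurable.ite measurableSet_Ioi (by fun_prop) measurable_const

lemma setLIntegral_Ioo_ofReal_mul_inv {l u c : ℝ} (hl : 0 < l) (hlu : l < u) (hc : 0 ≤ c) :
    ∫⁻ x in Ioo l u, ENNReal.ofReal (c * x⁻¹) = ENNReal.ofReal (c * log (u / l)) := by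
  have hint : IntervalIntegrable (fun x : ℝ => c * x⁻¹) volume l u :=
    (intervalIntegrable_inv_iff.2 (.inr fun h => by
      rw [uIcc_of_le hlu.le] at h; exact absurd h.1 hl.not_ge)).const_mul c
  rw [← integral_inv_of_pos hl (hl.trans hlu), ← intervalIntegral.integral_const_mul,
    intervalIntegral.integral_of_le hlu.le, integral_Ioc_eq_integral_Ioo,
    ofReal_integral_eq_lintegral_ofReal]
  · exact (intervalIntegrable_iff_integrableOn_Ioo_of_le hlu.le).1 hint
  · filter_upwards [ae_restrict_mem measurableSet_Ioo] with x hx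
    exact mul_nonneg hc (inv_nonneg.2 (hl.trans hx.1).le)

lemma paretoPdf_mul_inv_mul_paretoPdf {a θ η x z : ℝ} (hθ : 0 < θ) (hη : 0 < η)
    (hx : θ < x) (hz : η < x⁻¹ * z) :
    paretoPdf a θ x * (|x⁻¹| * paretoPdf a η (x⁻¹ * z))
      = a ^ 2 * (θ * η) ^ a * z ^ (-a - 1) * x⁻¹ := by
  have hx0 : 0 < x := hθ.trans hx
  have hz0 : 0 < z := pos_of_mul_pos_right (hη.trans hz) (inv_pos.2 hx0).le
  have hpow : x ^ (-a - 1) * (x ^ (-a - 1))⁻¹ = 1 := mul_inv_cancel₀ (rpow_pos_of_pos hx0 _).ne'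
  rw [paretoPdf, paretoPdf, if_pos hx, if_pos hz, abs_of_pos (inv_pos.2 hx0),
    mul_rpow (inv_pos.2 hx0).le hz0.le, mul_rpow hθ.le hη.le, inv_rpow hx0.le, neg_add']
  linear_combination a ^ 2 * θ ^ a * η ^ a * z ^ (-a - 1) * x⁻¹ * hpow

lemma paretoPdf_nonneg {a θ : ℝ} (ha : 0 ≤ a) (hθ : 0 < θ) (x : ℝ) : 0 ≤ paretoPdf a θ x := by
  unfold paretoPdf
  split_ifs with h
  · have := hθ.trans h
    positivity
  · rfl

/-- The multiplicative convolution of two Pareto densities of the same shape. -/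
lemma lintegral_paretoPdf_mul_paretoPdf {a θ η : ℝ} (ha : 0 ≤ a) (hθ : 0 < θ) (hη : 0 < η)
    (z : ℝ) :
    ∫⁻ x, ENNReal.ofReal (paretoPdf a θ x)
        * (ENNReal.ofReal |x⁻¹| * ENNReal.ofReal (paretoPdf a η (x⁻¹ * z)))
      = ENNReal.ofReal (if θ * η < z then
          a ^ 2 * (θ * η) ^ a * z ^ (-a - 1) * log (z / (θ * η)) else 0) := by
  have hind (x : ℝ) : ENNReal.ofReal (paretoPdf a θ x)
        * (ENNReal.ofReal |x⁻¹| * ENNReal.ofReal (paretoPdf a η (x⁻¹ * z)))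
      = (Ioo θ (z / η)).indicator
          (fun x => ENNReal.ofReal (a ^ 2 * (θ * η) ^ a * z ^ (-a - 1) * x⁻¹)) x := by
    by_cases hx : θ < x
    · have hiff : η < x⁻¹ * z ↔ x < z / η := by
        rw [lt_inv_mul_iff₀ (hθ.trans hx), lt_div_iff₀ hη]
      by_cases hz : η < x⁻¹ * z
      · rw [indicator_of_mem (show x ∈ Ioo θ (z / η) from ⟨hx, hiff.1 hz⟩),
          ← paretoPdf_mul_inv_mul_paretoPdf hθ hη hx hz,
          ENNReal.ofReal_mul (paretoPdf_nonneg ha hθ x), ENNReal.ofReal_mul (abs_nonneg _)]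
      · rw [indicator_of_notMem fun h => hz (hiff.2 h.2)]
        simp [paretoPdf, hz]
    · rw [indicator_of_notMem fun h => hx h.1]
      simp [paretoPdf, hx]
  rw [lintegral_congr hind, lintegral_indicator measurableSet_Ioo]
  split_ifs with hz
  · have hz0 : 0 < z := (mul_pos hθ hη).trans hz
    rw [setLIntegral_Ioo_ofReal_mul_inv hθ ((lt_div_iff₀ hη).2 hz) (by positivity), div_div,
      mul_comm η]
  · rw [Ioo_eq_empty fun h => hz ((lt_div_iff₀ hη).1 h)]
    simp

theorem product_of_independent_pareto_eq
    {Ω : Type*} [MeasurableSpace Ω] (P : Measure Ω) [IsProbabilityMeasure P]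
    (X Y : Ω → ℝ) (hXm : Measurable X) (hYm : Measurable Y)
    (hindep : IndepFun X Y P)
    (a θX θY : ℝ) (ha : 0 < a) (hθX : 0 < θX) (hθY : 0 < θY)
    (hX : Measure.map X P
      = (volume : Measure ℝ).withDensity (fun x => ENNReal.ofReal (paretoPdf a θX x)))
    (hY : Measure.map Y P
      = (volume : Measure ℝ).withDensity (fun y => ENNReal.ofReal (paretoPdf a θY y))) :
    Measure.map (fun ω => X ω * Y ω) P
      = (volume : Measure ℝ).withDensity (fun z => ENNReal.ofReal
          (if θX * θY < z then
            a ^ 2 * (θX * θY) ^ a * z ^ (-a - 1) * Real.log (z / (θX * θY))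
          else 0)) := by
  rw [map_mul_eq_withDensity_of_indepFun hXm hYm hindep
    (measurable_paretoPdf a θX).ennreal_ofReal (measurable_paretoPdf a θY).ennreal_ofReal hX hY]
  exact congrArg _ (funext (lintegral_paretoPdf_mul_paretoPdf ha.le hθX hθY))
end

section
/- Let X and Y be independent random variables on a probability space (Ω, 𝓕, ℙ), where X has the centered Gaussian distribution with standard deviation σ > 0 and Y has the Student's t distribution with n > 0 degrees of freedom. Then the product Z = X·Y has probability density function f_Z(z) = ( 2·Γ((n+1)/2) / (π·σ·√(2n)·Γ(n/2)) ) · ∫₀^∞ (1/x)·exp(−x²/(2σ²))·(1 + z²/(n·x²))^{-(n+1)/2} dx for every z ∈ ℝ. -/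
open MeasureTheory ProbabilityTheory Real

/-- The centered Gaussian probability density function with standard deviation `σ`. -/
noncomputable def gaussPdf (σ x : ℝ) : ℝ :=
  (1 / (Real.sqrt (2 * π) * σ)) * Real.exp (-x ^ 2 / (2 * σ ^ 2))

/-- The Student's t probability density function with `n` degrees of freedom. -/
noncomputable def studentPdf (n y : ℝ) : ℝ :=
  (Real.Gamma ((n + 1) / 2) / (Real.sqrt (n * π) * Real.Gamma (n / 2)))
    * (1 + y ^ 2 / n) ^ (-((n + 1) / 2))

/-- The law of the product of two independent real random variables with densities `f` and `g`. -/
theorem map_mul_eq_withDensity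
    {Ω : Type*} [MeasurableSpace Ω] {P : Measure Ω} [IsFiniteMeasure P]
    {X Y : Ω → ℝ} (hXm : Measurable X) (hYm : Measurable Y) (hindep : IndepFun X Y P)
    {f g : ℝ → ENNReal} (hf : Measurable f) (hg : Measurable g)
    (hX : P.map X = volume.withDensity f) (hY : P.map Y = volume.withDensity g) :
    P.map (fun ω => X ω * Y ω)
      = volume.withDensity (fun z => ∫⁻ x, f x * (ENNReal.ofReal |x⁻¹| * g (z / x))) := by
  have hprod := (indepFun_iff_map_prod_eq_prod_map_map hXm.aemeasurable hYm.aemeasurable).1 hindep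
  refine Measure.ext_of_lintegral _ fun H hH => ?_
  have hdens : Measurable
      (Function.uncurry fun z x : ℝ => f x * (ENNReal.ofReal |x⁻¹| * g (z / x))) := by
    unfold Function.uncurry
    fun_prop
  have hscale (x : ℝ) (hx : x ≠ 0) : ∫⁻ y, g y * H (x * y)
      = ∫⁻ z, ENNReal.ofReal |x⁻¹| * g (z / x) * H z := by
    have hmap := lintegral_map (μ := (volume : Measure ℝ)) (f := fun z => g (z / x) * H z)
      (by fun_prop) (measurable_const_mul x)
    rw [Real.map_volume_mul_left hx, lintegral_smul_measure, smul_eq_mul,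
      ← lintegral_const_mul _ (by fun_prop)] at hmap
    simp_rw [mul_div_cancel_left₀ _ hx] at hmap
    simp_rw [← hmap, mul_assoc]
  have hjoint : ∫⁻ z, H z ∂(P.map fun ω => X ω * Y ω)
      = ∫⁻ p : ℝ × ℝ, H (p.1 * p.2) ∂((P.map X).prod (P.map Y)) := by
    rw [← hprod, lintegral_map hH (by fun_prop), lintegral_map (by fun_prop) (by fun_prop)]
  have : IsFiniteMeasure (volume.withDensity g) := hY ▸ inferInstance
  have hinner : Measurable fun x => ∫⁻ y, H (x * y) ∂(volume.withDensity g) :=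
    Measurable.lintegral_prod_right' (f := fun p : ℝ × ℝ => H (p.1 * p.2)) (by fun_prop)
  rw [hjoint, lintegral_prod _ (by fun_prop), hX, hY,
    lintegral_withDensity_eq_lintegral_mul _ hf hinner,
    lintegral_withDensity_eq_lintegral_mul _ hdens.lintegral_prod_right hH]
  calc
    _ = ∫⁻ x, ∫⁻ z, f x * (ENNReal.ofReal |x⁻¹| * g (z / x)) * H z := by
      refine lintegral_congr_ae ?_
      filter_upwards [Measure.ae_ne volume (0 : ℝ)] with x hx
      simp only [Pi.mul_apply]
      rw [lintegral_withDensity_eq_lintegral_mul _ hg (by fun_prop)]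
      simp only [Pi.mul_apply]
      rw [hscale x hx, ← lintegral_const_mul _ (by fun_prop)]
      simp_rw [mul_assoc]
    _ = ∫⁻ z, ∫⁻ x, f x * (ENNReal.ofReal |x⁻¹| * g (z / x)) * H z :=
      lintegral_lintegral_swap (by fun_prop)
    _ = _ := by
      refine lintegral_congr fun z => ?_
      rw [lintegral_mul_const _ (by fun_prop), Pi.mul_apply]

/-- The integral of an even function over the real line is twice that over the positive reals. -/
theorem lintegral_eq_two_mul_setLIntegral_Ioi {f : ℝ → ENNReal} (hf : ∀ x, f (-x) = f x) :
    ∫⁻ x, f x = 2 * ∫⁻ x in Set.Ioi (0 : ℝ), f x := by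
  have hneg : ∫⁻ x in Set.Iic (0 : ℝ), f x = ∫⁻ x in Set.Ioi (0 : ℝ), f x := by
    have hpre := (Measure.measurePreserving_neg (volume : Measure ℝ)).setLIntegral_comp_preimage_emb
      (MeasurableEquiv.neg ℝ).measurableEmbedding f (Set.Iio 0)
    have hset : (Neg.neg : ℝ → ℝ) ⁻¹' Set.Iio 0 = Set.Ioi 0 := by
      ext x
      simp
    rw [← setLIntegral_congr Iio_ae_eq_Iic, ← hpre, hset]
    simp_rw [hf]
  rw [← lintegral_add_compl f (measurableSet_Ioi (a := (0 : ℝ))), Set.compl_Ioi, hneg, two_mul]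

theorem measurable_gaussPdf (σ : ℝ) : Measurable (gaussPdf σ) := by
  unfold gaussPdf
  fun_prop

theorem measurable_studentPdf (n : ℝ) : Measurable (studentPdf n) := by
  unfold studentPdf
  fun_prop

theorem gaussPdf_nonneg {σ : ℝ} (hσ : 0 < σ) (x : ℝ) : 0 ≤ gaussPdf σ x := by
  unfold gaussPdf
  positivity

theorem gaussPdf_mul_studentPdf_div {σ n : ℝ} (z : ℝ) {x : ℝ} (hx : 0 < x) :
    gaussPdf σ x * (|x⁻¹| * studentPdf n (z / x))
      = (Real.Gamma ((n + 1) / 2) / (π * σ * √(2 * n) * Real.Gamma (n / 2)))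
        * ((1 / x) * Real.exp (-x ^ 2 / (2 * σ ^ 2))
          * (1 + z ^ 2 / (n * x ^ 2)) ^ (-((n + 1) / 2))) := by
  have hsqrt : π * √(2 * n) = √(2 * π) * √(n * π) := by
    rw [← Real.sqrt_mul (by positivity) (n * π), show 2 * π * (n * π) = π ^ 2 * (2 * n) by ring,
      Real.sqrt_mul (sq_nonneg π), Real.sqrt_sq Real.pi_pos.le]
  have hden : π * σ * √(2 * n) * Real.Gamma (n / 2)
      = √(2 * π) * σ * (√(n * π) * Real.Gamma (n / 2)) := by
    linear_combination σ * Real.Gamma (n / 2) * hsqrt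
  have harg : (z / x) ^ 2 / n = z ^ 2 / (n * x ^ 2) := by
    rw [div_pow, div_div, mul_comm n]
  unfold gaussPdf studentPdf
  rw [hden, harg, abs_of_pos (inv_pos.2 hx), ← one_div]
  simp only [div_eq_mul_inv, mul_inv]
  ring

theorem product_of_gaussian_student
    {Ω : Type*} [MeasurableSpace Ω] (P : Measure Ω) [IsProbabilityMeasure P]
    (X Y : Ω → ℝ) (hXm : Measurable X) (hYm : Measurable Y)
    (hindep : IndepFun X Y P)
    (σ n : ℝ) (hσ : 0 < σ) (hn : 0 < n)
    (hX : Measure.map X P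
      = (volume : Measure ℝ).withDensity (fun x => ENNReal.ofReal (gaussPdf σ x)))
    (hY : Measure.map Y P
      = (volume : Measure ℝ).withDensity (fun y => ENNReal.ofReal (studentPdf n y))) :
    Measure.map (fun ω => X ω * Y ω) P
      = (volume : Measure ℝ).withDensity (fun z => ENNReal.ofReal
          ((2 * Real.Gamma ((n + 1) / 2)
              / (π * σ * Real.sqrt (2 * n) * Real.Gamma (n / 2)))
            * ∫ x in Set.Ioi (0:ℝ), (1 / x) * Real.exp (-x ^ 2 / (2 * σ ^ 2))
                * (1 + z ^ 2 / (n * x ^ 2)) ^ (-((n + 1) / 2)))) := by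
  have hgm := measurable_gaussPdf σ
  have hsm := measurable_studentPdf n
  have hlaw := map_mul_eq_withDensity hXm hYm hindep hgm.ennreal_ofReal hsm.ennreal_ofReal hX hY
  have hmeas : Measurable fun z : ℝ => ∫⁻ x, ENNReal.ofReal (gaussPdf σ x)
      * (ENNReal.ofReal |x⁻¹| * ENNReal.ofReal (studentPdf n (z / x))) := by
    refine Measurable.lintegral_prod_right ?_
    unfold Function.uncurry
    fun_prop
  have hfin : ∀ᵐ z : ℝ, ∫⁻ x, ENNReal.ofReal (gaussPdf σ x)
      * (ENNReal.ofReal |x⁻¹| * ENNReal.ofReal (studentPdf n (z / x))) < ⊤ := by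
    refine ae_lt_top hmeas ?_
    rw [← setLIntegral_univ, ← withDensity_apply _ MeasurableSet.univ, ← hlaw]
    exact measure_ne_top _ _
  rw [hlaw]
  refine withDensity_congr_ae ?_
  filter_upwards [hfin] with z hz
  set k : ℝ → ℝ := fun x => (1 / x) * Real.exp (-x ^ 2 / (2 * σ ^ 2))
    * (1 + z ^ 2 / (n * x ^ 2)) ^ (-((n + 1) / 2)) with hk
  set c : ℝ := Real.Gamma ((n + 1) / 2) / (π * σ * √(2 * n) * Real.Gamma (n / 2)) with hc
  have hc0 : 0 < c := by
    have := Real.Gamma_pos_of_pos (show 0 < (n + 1) / 2 by positivity)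
    have := Real.Gamma_pos_of_pos (show 0 < n / 2 by positivity)
    positivity
  have hkm : Measurable k := by fun_prop
  have hk0 : 0 ≤ᵐ[volume.restrict (Set.Ioi (0 : ℝ))] k := by
    filter_upwards [ae_restrict_mem measurableSet_Ioi] with x hx
    have : 0 < x := hx
    simp only [hk, Pi.zero_apply]
    positivity
  have hconv : ∫⁻ x, ENNReal.ofReal (gaussPdf σ x)
      * (ENNReal.ofReal |x⁻¹| * ENNReal.ofReal (studentPdf n (z / x)))
      = ENNReal.ofReal (2 * c) * ∫⁻ x in Set.Ioi (0 : ℝ), ENNReal.ofReal (k x) := by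
    rw [lintegral_eq_two_mul_setLIntegral_Ioi (fun x => by
        simp [gaussPdf, studentPdf, inv_neg, div_neg]),
      ENNReal.ofReal_mul zero_le_two, mul_assoc, ← lintegral_const_mul _ hkm.ennreal_ofReal,
      ENNReal.ofReal_ofNat]
    congr 1
    refine setLIntegral_congr_fun measurableSet_Ioi fun x hx => ?_
    rw [← ENNReal.ofReal_mul (abs_nonneg _), ← ENNReal.ofReal_mul (gaussPdf_nonneg hσ x),
      gaussPdf_mul_studentPdf_div z hx, ENNReal.ofReal_mul hc0.le]
  have hint : Integrable k (volume.restrict (Set.Ioi 0)) := by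
    refine ⟨hkm.aestronglyMeasurable, (hasFiniteIntegral_iff_ofReal hk0).2 ?_⟩
    rw [hconv] at hz
    exact ENNReal.lt_top_of_mul_ne_top_right hz.ne (by simpa using hc0)
  rw [hconv, ← ofReal_integral_eq_lintegral_ofReal hint hk0, ← ENNReal.ofReal_mul (by positivity),
    hc, mul_div_assoc]
end
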